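/- arXiv:1410.6072 — 2 statements merged into one kernel-verified Lean document; each statement's English description precedes it below -/
import Mathlib

section
/- Let e₁, e₂ be the standard basis vectors of ℝ² and define C = (1/√3)(e₁⊗e₁⊗e₂ + e₁⊗e₂⊗e₁ + e₂⊗e₁⊗e₁) ∈ ℝ^{2×2×2} ⊆ ℂ^{2×2×2}. Then ‖C‖_{σ,ℝ} = ‖C‖_{σ,ℂ} = 2/3, ‖C‖_{*,ℝ} = √3, and ‖C‖_{*,ℂ} = 3/2. In particular the real and complex nuclear norms of C differ. -/
open scoped BigOperators

noncomputable section

variable {𝕜 : Type} [RCLike 𝕜]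

/-- The outer (tensor) product of vectors `x k ∈ 𝕜^{n k}`, giving the rank-one tensor
with entries `∏ k, (x k) (i k)`. -/
def rankOne {ι : Type} [Fintype ι] {n : ι → ℕ}
    (x : (k : ι) → EuclideanSpace 𝕜 (Fin (n k))) : ((k : ι) → Fin (n k)) → 𝕜 :=
  fun i => ∏ k, x k (i k)

/-- The Hermitian inner product of two tensors (conjugation on the second argument). -/
def tInner {ι : Type} [Fintype ι] [DecidableEq ι] {n : ι → ℕ}
    (A B : ((k : ι) → Fin (n k)) → 𝕜) : 𝕜 :=
  ∑ i, A i * (starRingEnd 𝕜) (B i)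

/-- The spectral norm of a tensor. -/
def specNorm {ι : Type} [Fintype ι] [DecidableEq ι] {n : ι → ℕ}
    (A : ((k : ι) → Fin (n k)) → 𝕜) : ℝ :=
  sSup { r : ℝ | ∃ x : (k : ι) → EuclideanSpace 𝕜 (Fin (n k)),
    (∀ k, ‖x k‖ = 1) ∧ r = ‖tInner A (rankOne x)‖ }

/-- The nuclear norm of a tensor. -/
def nucNorm {ι : Type} [Fintype ι] [DecidableEq ι] {n : ι → ℕ}
    (A : ((k : ι) → Fin (n k)) → 𝕜) : ℝ :=
  sInf { s : ℝ | ∃ (r : ℕ) (x : Fin r → (k : ι) → EuclideanSpace 𝕜 (Fin (n k))),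
    A = (∑ i, rankOne (x i)) ∧ s = ∑ i, ∏ k, ‖x i k‖ }

/-- The standard basis vectors `e₁, e₂` of `ℝ²`. -/
def stdBasis (j : Fin 2) : EuclideanSpace ℝ (Fin 2) := EuclideanSpace.single j 1

/-- The tensor `C = (1/√3)(e₁⊗e₁⊗e₂ + e₁⊗e₂⊗e₁ + e₂⊗e₁⊗e₁) ∈ ℝ^{2×2×2}`. -/
def tenC : (Fin 3 → Fin 2) → ℝ :=
  (1 / Real.sqrt 3 : ℝ) • (rankOne ![stdBasis 0, stdBasis 0, stdBasis 1]
    + rankOne ![stdBasis 0, stdBasis 1, stdBasis 0]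
    + rankOne ![stdBasis 1, stdBasis 0, stdBasis 0])

theorem sum_fin_three_fin_two {M : Type*} [AddCommMonoid M] (f : (Fin 3 → Fin 2) → M) :
    ∑ i, f i = f ![0, 0, 0] + (f ![0, 0, 1] + (f ![0, 1, 0] + (f ![0, 1, 1] +
      (f ![1, 0, 0] + (f ![1, 0, 1] + (f ![1, 1, 0] + f ![1, 1, 1])))))) := by
  have h : (Finset.univ : Finset (Fin 3 → Fin 2)) =
      {![0, 0, 0], ![0, 0, 1], ![0, 1, 0], ![0, 1, 1],
        ![1, 0, 0], ![1, 0, 1], ![1, 1, 0], ![1, 1, 1]} := by decide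
  rw [h]
  repeat rw [Finset.sum_insert (by decide)]
  rw [Finset.sum_singleton]

theorem forall_fin_three_fin_two {p : (Fin 3 → Fin 2) → Prop}
    (h000 : p ![0, 0, 0]) (h001 : p ![0, 0, 1]) (h010 : p ![0, 1, 0]) (h011 : p ![0, 1, 1])
    (h100 : p ![1, 0, 0]) (h101 : p ![1, 0, 1]) (h110 : p ![1, 1, 0]) (h111 : p ![1, 1, 1])
    (i : Fin 3 → Fin 2) : p i := by
  have hi : i = ![i 0, i 1, i 2] := by ext k; fin_cases k <;> rfl
  rw [hi]
  generalize i 0 = a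
  generalize i 1 = b
  generalize i 2 = c
  fin_cases a <;> fin_cases b <;> fin_cases c <;> assumption

theorem tenC_apply (i : Fin 3 → Fin 2) :
    tenC i = if i = ![0, 0, 1] ∨ i = ![0, 1, 0] ∨ i = ![1, 0, 0] then 1 / Real.sqrt 3 else 0 := by
  induction i using forall_fin_three_fin_two <;>
    simp [tenC, rankOne, stdBasis, Fin.prod_univ_three]

theorem rankOne_apply_three (x : Fin 3 → EuclideanSpace 𝕜 (Fin 2)) (a b c : Fin 2) :
    rankOne (n := fun _ => 2) x ![a, b, c] = x 0 a * x 1 b * x 2 c := by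
  simp [rankOne, Fin.prod_univ_three]

theorem tInner_ofReal_tenC {A : (Fin 3 → Fin 2) → 𝕜} (hA : ∀ i, A i = ((tenC i : ℝ) : 𝕜))
    (x : Fin 3 → EuclideanSpace 𝕜 (Fin 2)) :
    tInner (n := fun _ => 2) A (rankOne x) = ((1 / Real.sqrt 3 : ℝ) : 𝕜) * (starRingEnd 𝕜)
      (x 0 0 * x 1 0 * x 2 1 + x 0 0 * x 1 1 * x 2 0 + x 0 1 * x 1 0 * x 2 0) := by
  unfold tInner
  rw [sum_fin_three_fin_two]
  simp only [hA, tenC_apply, rankOne_apply_three]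
  simp
  ring

theorem sq_wForm_le (a b c d e f : ℝ) :
    (a * c * f + a * d * e + b * c * e) ^ 2 ≤
      4 / 3 * ((a ^ 2 + b ^ 2) * (c ^ 2 + d ^ 2) * (e ^ 2 + f ^ 2)) := by
  have h1 : (a * c * f + a * d * e + b * c * e) ^ 2 ≤
      (a ^ 2 + b ^ 2) * ((c * f + d * e) ^ 2 + (c * e) ^ 2) := by
    nlinarith [sq_nonneg (a * (c * e) - b * (c * f + d * e))]
  have h2 : (c * f + d * e) ^ 2 + (c * e) ^ 2 ≤
      4 / 3 * ((c ^ 2 + d ^ 2) * (e ^ 2 + f ^ 2)) := by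
    nlinarith [sq_nonneg (c * e - 2 * (d * f)), sq_nonneg (c * f - d * e)]
  have h3 := mul_le_mul_of_nonneg_left h2 (by positivity : 0 ≤ a ^ 2 + b ^ 2)
  linarith

theorem norm_wForm_le (x : Fin 3 → EuclideanSpace 𝕜 (Fin 2)) :
    ‖x 0 0 * x 1 0 * x 2 1 + x 0 0 * x 1 1 * x 2 0 + x 0 1 * x 1 0 * x 2 0‖ ≤
      2 / Real.sqrt 3 * ∏ k, ‖x k‖ := by
  have h : ‖x 0 0 * x 1 0 * x 2 1 + x 0 0 * x 1 1 * x 2 0 + x 0 1 * x 1 0 * x 2 0‖ ≤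
      ‖x 0 0‖ * ‖x 1 0‖ * ‖x 2 1‖ + ‖x 0 0‖ * ‖x 1 1‖ * ‖x 2 0‖
        + ‖x 0 1‖ * ‖x 1 0‖ * ‖x 2 0‖ := by
    refine norm_add₃_le.trans_eq ?_
    simp only [norm_mul]
  refine h.trans (abs_le_of_sq_le_sq' ?_ (by positivity)).2
  refine (sq_wForm_le _ _ _ _ _ _).trans_eq ?_
  rw [mul_pow, div_pow, Real.sq_sqrt (by norm_num), Fin.prod_univ_three, mul_pow, mul_pow]
  simp only [EuclideanSpace.norm_sq_eq, Fin.sum_univ_two]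
  norm_num

theorem specNorm_ofReal_tenC {A : (Fin 3 → Fin 2) → 𝕜}
    (hA : ∀ i, A i = ((tenC i : ℝ) : 𝕜)) :
    specNorm (n := fun _ => 2) A = 2 / 3 := by
  have h3 : Real.sqrt 3 * Real.sqrt 3 = 3 := Real.mul_self_sqrt (by norm_num)
  refine IsGreatest.csSup_eq ⟨?_, ?_⟩
  · refine ⟨fun _ => WithLp.toLp 2 ![((Real.sqrt 2 / Real.sqrt 3 : ℝ) : 𝕜),
      ((1 / Real.sqrt 3 : ℝ) : 𝕜)], fun _ => ?_, ?_⟩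
    · rw [EuclideanSpace.norm_eq, Real.sqrt_eq_one, Fin.sum_univ_two]
      simp only [Matrix.cons_val_zero, Matrix.cons_val_one, RCLike.norm_ofReal,
        sq_abs, div_pow, Real.sq_sqrt (show (0 : ℝ) ≤ 3 by norm_num),
        Real.sq_sqrt (show (0 : ℝ) ≤ 2 by norm_num)]
      norm_num
    · rw [tInner_ofReal_tenC hA, norm_mul, RCLike.norm_conj]
      simp only [Matrix.cons_val_zero, Matrix.cons_val_one]
      simp only [← RCLike.ofReal_mul, ← RCLike.ofReal_add]
      rw [RCLike.norm_ofReal, RCLike.norm_ofReal, ← abs_mul, abs_of_nonneg (by positivity)]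
      field_simp
      rw [Real.sq_sqrt (by norm_num), show Real.sqrt 3 ^ 4 = (Real.sqrt 3 * Real.sqrt 3) ^ 2 by ring,
        h3]
      norm_num
  · rintro r ⟨x, hx, rfl⟩
    rw [tInner_ofReal_tenC hA, norm_mul, RCLike.norm_conj, RCLike.norm_ofReal,
      abs_of_nonneg (by positivity)]
    have h := norm_wForm_le x
    simp only [hx, Finset.prod_const_one, mul_one] at h
    calc _ ≤ 1 / Real.sqrt 3 * (2 / Real.sqrt 3) := by gcongr
      _ = 2 / 3 := by rw [div_mul_div_comm, h3, one_mul]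

theorem three_halves_le_of_sum_rankOne {A : (Fin 3 → Fin 2) → 𝕜}
    (hA : ∀ i, A i = ((tenC i : ℝ) : 𝕜)) {r : ℕ} {x : Fin r → Fin 3 → EuclideanSpace 𝕜 (Fin 2)}
    (h : A = ∑ i, rankOne (n := fun _ => 2) (x i)) : 3 / 2 ≤ ∑ i, ∏ k, ‖x i k‖ := by
  have h3 : Real.sqrt 3 * Real.sqrt 3 = 3 := Real.mul_self_sqrt (by norm_num)
  have hpos : 0 < Real.sqrt 3 := by positivity
  have key : ((Real.sqrt 3 : ℝ) : 𝕜) = ∑ i, (x i 0 0 * x i 1 0 * x i 2 1 +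
      x i 0 0 * x i 1 1 * x i 2 0 + x i 0 1 * x i 1 0 * x i 2 0) := by
    have e : ((Real.sqrt 3 : ℝ) : 𝕜) = A ![0, 0, 1] + A ![0, 1, 0] + A ![1, 0, 0] := by
      simp only [hA, tenC_apply, ← RCLike.ofReal_add]
      congr 1
      simp
      field_simp
      linarith
    rw [e, h]
    simp only [Finset.sum_apply, rankOne_apply_three, Finset.sum_add_distrib]
  have h1 : Real.sqrt 3 ≤ 2 / Real.sqrt 3 * ∑ i, ∏ k, ‖x i k‖ := by
    calc Real.sqrt 3 = ‖((Real.sqrt 3 : ℝ) : 𝕜)‖ := by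
          rw [RCLike.norm_ofReal, abs_of_pos hpos]
      _ ≤ _ := by
          rw [key, Finset.mul_sum]
          exact norm_sum_le_of_le _ fun i _ => norm_wForm_le (x i)
  rw [div_mul_eq_mul_div, le_div_iff₀ hpos, h3] at h1
  linarith

theorem abs_im_form_le (x : Fin 3 → EuclideanSpace ℝ (Fin 2)) :
    |x 0 0 * x 1 0 * x 2 1 + x 0 0 * x 1 1 * x 2 0 + x 0 1 * x 1 0 * x 2 0
      - x 0 1 * x 1 1 * x 2 1| ≤ ∏ k, ‖x k‖ := by
  refine abs_le_of_sq_le_sq ?_ (by positivity)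
  rw [Fin.prod_univ_three, mul_pow, mul_pow]
  simp only [EuclideanSpace.real_norm_sq_eq, Fin.sum_univ_two]
  nlinarith [sq_nonneg (x 0 0 * x 1 0 * x 2 0 - x 0 0 * x 1 1 * x 2 1
    - x 0 1 * x 1 0 * x 2 1 - x 0 1 * x 1 1 * x 2 0)]

theorem sqrt_three_le_of_sum_rankOne {r : ℕ} {x : Fin r → Fin 3 → EuclideanSpace ℝ (Fin 2)}
    (h : tenC = ∑ i, rankOne (n := fun _ => 2) (x i)) :
    Real.sqrt 3 ≤ ∑ i, ∏ k, ‖x i k‖ := by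
  have e : Real.sqrt 3 = tenC ![0, 0, 1] + tenC ![0, 1, 0] + tenC ![1, 0, 0]
      - tenC ![1, 1, 1] := by
    have h3 : Real.sqrt 3 * Real.sqrt 3 = 3 := Real.mul_self_sqrt (by norm_num)
    simp only [tenC_apply]
    simp
    field_simp
    linarith
  rw [e, h]
  simp only [Finset.sum_apply, rankOne_apply_three]
  rw [← Finset.sum_add_distrib, ← Finset.sum_add_distrib, ← Finset.sum_sub_distrib]
  exact Finset.sum_le_sum fun i _ => (le_abs_self _).trans (abs_im_form_le (x i))

theorem nucNorm_tenC : nucNorm tenC = Real.sqrt 3 := by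
  have h3 : Real.sqrt 3 * Real.sqrt 3 = 3 := Real.mul_self_sqrt (by norm_num)
  refine IsLeast.csInf_eq ⟨?_, ?_⟩
  · refine ⟨3, ![![(1 / Real.sqrt 3) • stdBasis 0, stdBasis 0, stdBasis 1],
      ![(1 / Real.sqrt 3) • stdBasis 0, stdBasis 1, stdBasis 0],
      ![(1 / Real.sqrt 3) • stdBasis 1, stdBasis 0, stdBasis 0]], ?_, ?_⟩
    · ext i
      rw [tenC_apply]
      induction i using forall_fin_three_fin_two <;>
        simp [rankOne, stdBasis, Fin.prod_univ_three, Fin.sum_univ_three]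
    · simp [stdBasis, Fin.prod_univ_three, Fin.sum_univ_three, norm_smul, abs_of_nonneg]
      field_simp
      linarith
  · rintro s ⟨r, x, hx, rfl⟩
    exact sqrt_three_le_of_sum_rankOne hx

/-- The unit vector `(√2 e₁ + ζ e₂) / √3`. -/
def phaseVec (ζ : ℂ) : EuclideanSpace ℂ (Fin 2) :=
  WithLp.toLp 2 ![((Real.sqrt 2 / Real.sqrt 3 : ℝ) : ℂ), ((1 / Real.sqrt 3 : ℝ) : ℂ) * ζ]

theorem norm_phaseVec {ζ : ℂ} (hζ : ‖ζ‖ = 1) : ‖phaseVec ζ‖ = 1 := by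
  rw [EuclideanSpace.norm_eq, Real.sqrt_eq_one, Fin.sum_univ_two]
  simp only [phaseVec, PiLp.toLp_apply, Matrix.cons_val_zero, Matrix.cons_val_one, norm_mul, hζ,
    Complex.norm_real, Real.norm_eq_abs, mul_one, sq_abs, div_pow,
    Real.sq_sqrt (show (0 : ℝ) ≤ 3 by norm_num), Real.sq_sqrt (show (0 : ℝ) ≤ 2 by norm_num)]
  norm_num

theorem nucNorm_complex_tenC : nucNorm (fun i => (tenC i : ℂ)) = 3 / 2 := by
  refine IsLeast.csInf_eq ⟨?_, ?_⟩
  · obtain ⟨ω, hω⟩ : ∃ ω : ℂ, IsPrimitiveRoot ω 3 :=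
      ⟨_, Complex.isPrimitiveRoot_exp 3 (by norm_num)⟩
    have hn : ‖ω‖ = 1 := hω.norm'_eq_one (by norm_num)
    have hω3 : ω ^ 3 = 1 := hω.pow_eq_one
    have hω2 : 1 + ω + ω ^ 2 = 0 := by
      simpa [Finset.sum_range_succ] using hω.geom_sum_eq_zero (by norm_num)
    have h3 : (Real.sqrt 3 : ℂ) ^ 2 = 3 := by
      rw [← Complex.ofReal_pow, Real.sq_sqrt (by norm_num)]; norm_num
    have h2 : (Real.sqrt 2 : ℂ) ^ 2 = 2 := by
      rw [← Complex.ofReal_pow, Real.sq_sqrt (by norm_num)]; norm_num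
    have h3' : (Real.sqrt 3 : ℂ) ≠ 0 := by
      rw [Complex.ofReal_ne_zero]; positivity
    refine ⟨3, ![![(1 / 2 : ℂ) • phaseVec 1, phaseVec 1, phaseVec 1],
      ![(ω ^ 2 / 2 : ℂ) • phaseVec ω, phaseVec ω, phaseVec ω],
      ![(ω / 2 : ℂ) • phaseVec (ω ^ 2), phaseVec (ω ^ 2), phaseVec (ω ^ 2)]], ?_, ?_⟩
    · ext i
      rw [tenC_apply]
      induction i using forall_fin_three_fin_two <;>
        simp [rankOne, phaseVec, Fin.prod_univ_three, Fin.sum_univ_three] <;>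
        field_simp
      case h000 => linear_combination -(Real.sqrt 2 : ℂ) ^ 3 * hω2
      case h001 | h010 | h100 =>
        linear_combination 2 * h3 - (1 + 2 * ω ^ 3) * h2 - 4 * hω3
      case h011 | h101 | h110 =>
        linear_combination -(Real.sqrt 2 : ℂ) * (hω2 + (ω + ω ^ 2) * hω3)
      case h111 => linear_combination -hω2 - (ω ^ 2 + ω * (ω ^ 3 + 1)) * hω3
    · simp only [Fin.prod_univ_three, Fin.sum_univ_three]
      simp [norm_smul, norm_phaseVec, hn]
      norm_num
  · rintro s ⟨r, x, hx, rfl⟩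
    exact three_halves_le_of_sum_rankOne (fun _ => rfl) hx

/-- Lemma 6.2: the real and complex spectral and nuclear norms of `C`; in particular
`‖C‖_{*,ℝ} ≠ ‖C‖_{*,ℂ}`. -/
theorem stmt13 :
    specNorm tenC = 2/3 ∧
    specNorm (fun i => (tenC i : ℂ)) = 2/3 ∧
    nucNorm tenC = Real.sqrt 3 ∧
    nucNorm (fun i => (tenC i : ℂ)) = 3/2 ∧
    nucNorm tenC ≠ nucNorm (fun i => (tenC i : ℂ)) := by
  refine ⟨specNorm_ofReal_tenC fun _ => rfl, specNorm_ofReal_tenC fun _ => rfl, nucNorm_tenC,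
    nucNorm_complex_tenC, ?_⟩
  rw [nucNorm_tenC, nucNorm_complex_tenC]
  intro h
  have h3 : Real.sqrt 3 * Real.sqrt 3 = 3 := Real.mul_self_sqrt (by norm_num)
  rw [h] at h3
  norm_num at h3
end
end

section
/- Let A ∈ ℂ^{n₁×⋯×n_d} and let |A| denote the tensor whose entries are the absolute values of the entries of A. Then ‖A‖_{σ,ℂ} ≤ ‖|A|‖_{σ,ℂ}, and ‖|A|‖_{σ,ℂ} = ‖|A|‖_{σ,ℝ}. -/
open scoped BigOperators

noncomputable section

variable {𝕜 : Type} [RCLike 𝕜]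

lemma bddAbove_specNorm_set {ι : Type} [Fintype ι] [DecidableEq ι] {n : ι → ℕ}
    (A : ((k : ι) → Fin (n k)) → 𝕜) :
    BddAbove { r : ℝ | ∃ x : (k : ι) → EuclideanSpace 𝕜 (Fin (n k)),
      (∀ k, ‖x k‖ = 1) ∧ r = ‖tInner A (rankOne x)‖ } := by
  refine ⟨∑ i, ‖A i‖, ?_⟩
  rintro r ⟨x, hx, rfl⟩
  refine (norm_sum_le _ _).trans (Finset.sum_le_sum fun i _ => ?_)
  rw [norm_mul, RCLike.norm_conj, rankOne, norm_prod]
  refine mul_le_of_le_one_right (norm_nonneg _)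
    (Finset.prod_le_one (fun k _ => norm_nonneg _) fun k _ => ?_)
  exact (PiLp.norm_apply_le (x k) (i k)).trans (hx k).le

lemma specNorm_nonneg {ι : Type} [Fintype ι] [DecidableEq ι] {n : ι → ℕ}
    (A : ((k : ι) → Fin (n k)) → 𝕜) : 0 ≤ specNorm A := by
  refine Real.sSup_nonneg ?_
  rintro r ⟨x, -, rfl⟩
  exact norm_nonneg _

/-- Replacing a tensor by its entrywise absolute value, possibly over another field,
does not decrease the spectral norm. -/
lemma specNorm_le_specNorm_norm {𝕜' : Type} [RCLike 𝕜'] {ι : Type} [Fintype ι] [DecidableEq ι]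
    {n : ι → ℕ} (A : ((k : ι) → Fin (n k)) → 𝕜) :
    specNorm A ≤ specNorm (fun i => ((‖A i‖ : ℝ) : 𝕜')) := by
  refine Real.sSup_le ?_ (specNorm_nonneg _)
  rintro r ⟨x, hx, rfl⟩
  let y : (k : ι) → EuclideanSpace 𝕜' (Fin (n k)) :=
    fun k => WithLp.toLp 2 fun j => ((‖x k j‖ : ℝ) : 𝕜')
  have hy : ∀ k, ‖y k‖ = 1 := fun k => by
    rw [← hx k, EuclideanSpace.norm_eq, EuclideanSpace.norm_eq]
    simp [y]
  have hxy : tInner (fun i => ((‖A i‖ : ℝ) : 𝕜')) (rankOne y) =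
      ((∑ i, ‖A i * (starRingEnd 𝕜) (rankOne x i)‖ : ℝ) : 𝕜') := by
    simp [tInner, rankOne, y, norm_prod]
  refine le_trans ?_ (le_csSup (bddAbove_specNorm_set _) ⟨y, hy, rfl⟩)
  rw [hxy, RCLike.norm_ofReal]
  exact (norm_sum_le _ _).trans (le_abs_self _)

/-- Lemma 6.3: for a complex tensor `A`, `‖A‖_{σ,ℂ} ≤ ‖|A|‖_{σ,ℂ}` where `|A|` is the
entrywise absolute value, and `‖|A|‖_{σ,ℂ} = ‖|A|‖_{σ,ℝ}`. -/
theorem stmt14 {d : ℕ} {n : Fin d → ℕ} (A : ((k : Fin d) → Fin (n k)) → ℂ) :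
    specNorm A ≤ specNorm (fun i => ((‖A i‖ : ℝ) : ℂ)) ∧
    specNorm (fun i => ((‖A i‖ : ℝ) : ℂ)) = specNorm (fun i => (‖A i‖ : ℝ)) := by
  refine ⟨specNorm_le_specNorm_norm A, le_antisymm ?_ ?_⟩
  · simpa using specNorm_le_specNorm_norm (𝕜' := ℝ) (fun i => ((‖A i‖ : ℝ) : ℂ))
  · simpa using specNorm_le_specNorm_norm (𝕜' := ℂ) (fun i => (‖A i‖ : ℝ))
end
end
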